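/- arXiv:1710.05963 — 2 statements merged into one kernel-verified Lean document; each statement's English description precedes it below -/
import Mathlib

section
/- Let p ≥ 1 and suppose that for each j ∈ {1,…,p} the j-th design column is regularly varying: x_{i,j} = i^{α_j} L_j(i) with exponent α_j > −1/2 and L_j a positive slowly varying sequence. Then the design conditions (C2), (C3) and (C4) hold, and for all j, l ∈ {1,…,p} and every k ≥ 0 the limit ρ_{j,l}(k) = lim_n Σ_{m=1}^{n-k} x_{m,j} x_{m+k,l}/(d_j(n) d_l(n)) exists, does not depend on k, and equals √(2α_j+1)·√(2α_l+1)/(α_j+α_l+1); in particular the design is regular. -/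
open Filter Finset Real Topology

noncomputable section

/-- A positive sequence is slowly varying if it is the restriction to `ℕ` of a measurable
positive function `ℓ` on `(0,∞)` with `ℓ(cx)/ℓ(x) → 1` as `x → ∞` for every `c > 0`. -/
def IsSlowlyVaryingSeq (L : ℕ → ℝ) : Prop :=
  ∃ ℓ : ℝ → ℝ, Measurable ℓ ∧ (∀ t : ℝ, 0 < t → 0 < ℓ t) ∧
    (∀ cc : ℝ, 0 < cc → Tendsto (fun t : ℝ => ℓ (cc * t) / ℓ t) atTop (𝓝 1)) ∧
    (∀ n : ℕ, L n = ℓ n)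

/-- The norm `d_j(n)` of the `j`-th column of the design. -/
def designNorm {p : ℕ} (x : ℕ → Fin p → ℝ) (j : Fin p) (n : ℕ) : ℝ :=
  Real.sqrt (∑ i ∈ Icc 1 n, x i j ^ 2)

/-- The uniform convergence theorem for slowly varying functions, in additive form. -/
theorem eventually_forall_abs_sub_lt_of_tendsto_sub {h : ℝ → ℝ} (hm : Measurable h)
    (hlim : ∀ u, Tendsto (fun t => h (t + u) - h t) atTop (𝓝 0)) {T ε : ℝ} (hT : 0 < T)
    (hε : 0 < ε) : ∀ᶠ t in atTop, ∀ u ∈ Set.Icc 0 T, |h (t + u) - h t| < ε := by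
  let bad : ℝ → Set ℝ := fun t => {v | ε / 2 ≤ |h (t + v) - h t|} ∩ Set.Icc 0 (2 * T)
  have hbad_meas (t : ℝ) : MeasurableSet (bad t) := by
    refine MeasurableSet.inter (measurableSet_le measurable_const ?_) measurableSet_Icc
    fun_prop
  have hbad : Tendsto (fun t => MeasureTheory.volume (bad t)) atTop (𝓝 0) := by
    have := MeasureTheory.tendsto_measure_of_ae_tendsto_indicator (μ := MeasureTheory.volume)
      (atTop : Filter ℝ) (A := ∅) (As := bad) (B := Set.Icc 0 (2 * T))
      MeasurableSet.empty hbad_meas measurableSet_Icc measure_Icc_lt_top.ne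
      (Eventually.of_forall fun t => Set.inter_subset_right) (by
        refine Eventually.of_forall fun v => ?_
        have := (hlim v).abs
        rw [abs_zero] at this
        filter_upwards [this.eventually_lt_const (half_pos hε)] with t ht
        simp [bad, ht])
    simpa using this
  have hsmall : ∀ᶠ t in atTop, MeasureTheory.volume (bad t) < ENNReal.ofReal (T / 2) :=
    hbad.eventually_lt_const (by simpa using hT)
  filter_upwards [eventually_forall_ge_atTop.2 hsmall] with t ht u hu
  have hcover : ¬ Set.Icc T (2 * T) ⊆ bad t ∪ (fun v => v + -u) ⁻¹' bad (t + u) := by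
    intro hsub
    have h₁ := (MeasureTheory.measure_mono (μ := MeasureTheory.volume) hsub).trans
      (MeasureTheory.measure_union_le _ _)
    rw [MeasureTheory.measure_preimage_add_right, Real.volume_Icc] at h₁
    have h₂ := h₁.trans_lt (ENNReal.add_lt_add (ht t le_rfl) (ht (t + u) (by linarith [hu.1])))
    rw [← ENNReal.ofReal_add (by positivity) (by positivity)] at h₂
    ring_nf at h₂
    exact lt_irrefl _ h₂
  obtain ⟨v, hv, hv'⟩ := Set.not_subset.1 hcover
  simp only [bad, Set.mem_union, Set.mem_inter_iff, Set.mem_ofPred_eq, Set.mem_preimage,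
    Set.mem_Icc, not_or, not_and] at hv' hv hu
  have h₁ : |h (t + v) - h t| < ε / 2 := by
    by_contra! hc
    exact hv'.1 hc (by linarith) (by linarith)
  have h₂ : |h (t + v) - h (t + u)| < ε / 2 := by
    by_contra! hc
    have htv : t + u + (v + -u) = t + v := by ring
    exact hv'.2 (by rwa [htv]) (by linarith) (by linarith)
  rw [abs_lt] at *
  constructor <;> linarith

/-- `M m / M n` is close to `1` for large `n`, uniformly in `n / 3 ≤ m ≤ n`. -/
def IsLocallyUniformlySlowlyVarying (M : ℕ → ℝ) : Prop :=
  ∀ ε > 0, ∀ᶠ n : ℕ in atTop, ∀ m : ℕ, m ≤ n → n ≤ 3 * m → |M m / M n - 1| ≤ ε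

theorem IsSlowlyVaryingSeq.isLocallyUniformlySlowlyVarying {L : ℕ → ℝ}
    (hL : IsSlowlyVaryingSeq L) : IsLocallyUniformlySlowlyVarying L := by
  obtain ⟨ℓ, hm, hpos, hlim, hLℓ⟩ := hL
  intro ε hε
  have hlog (u : ℝ) :
      Tendsto (fun t => log (ℓ (exp (t + u))) - log (ℓ (exp t))) atTop (𝓝 0) := by
    have h₁ := ((hlim (exp u) (exp_pos u)).comp tendsto_exp_atTop).log one_ne_zero
    rw [log_one] at h₁
    refine h₁.congr fun t => ?_
    rw [Function.comp_apply, log_div (hpos _ (by positivity)).ne' (hpos _ (by positivity)).ne',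
      exp_add, mul_comm]
  have hunif := eventually_forall_abs_sub_lt_of_tendsto_sub
    (h := fun t => log (ℓ (exp t))) (by fun_prop) hlog two_pos (ε := min (ε / 2) 1)
    (by positivity)
  obtain ⟨X, hX⟩ := eventually_atTop.1 hunif
  filter_upwards [tendsto_natCast_atTop_atTop.eventually_ge_atTop (3 * exp X),
    eventually_ge_atTop 1] with n hn hn1 m hmn hnm
  have hm0 : 0 < (m : ℝ) := by
    have : 0 < m := by omega
    exact_mod_cast this
  have hn0 : 0 < (n : ℝ) := by exact_mod_cast hn1
  have hmn' : (m : ℝ) ≤ n := by exact_mod_cast hmn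
  have hnm' : (n : ℝ) ≤ 3 * m := by exact_mod_cast hnm
  have hXm : X ≤ log m := by
    rw [le_log_iff_exp_le hm0]
    linarith
  have hu : log n - log m ∈ Set.Icc (0 : ℝ) 2 := by
    refine ⟨sub_nonneg.2 (log_le_log hm0 hmn'), ?_⟩
    rw [← log_div hn0.ne' hm0.ne']
    have h₁ := log_le_sub_one_of_pos (div_pos hn0 hm0)
    have h₂ : (n : ℝ) / m ≤ 3 := by rwa [div_le_iff₀ hm0]
    linarith
  have h₁ := hX _ hXm _ hu
  simp only [add_sub_cancel, exp_log hm0, exp_log hn0] at h₁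
  rw [abs_sub_comm, lt_min_iff] at h₁
  have h₂ := abs_exp_sub_one_le h₁.2.le
  rw [exp_sub, exp_log (hpos _ hm0), exp_log (hpos _ hn0)] at h₂
  rw [hLℓ, hLℓ]
  linarith

theorem tendsto_zero_of_eq_mul_half_add {e q δ : ℕ → ℝ} {r : ℝ} (hr : |r| < 1)
    (hq : Tendsto q atTop (𝓝 r)) (hδ : Tendsto δ atTop (𝓝 0))
    (he : ∀ᶠ n in atTop, e n = q n * e (n / 2) + δ n) : Tendsto e atTop (𝓝 0) := by
  obtain ⟨s, hrs, hs1⟩ := exists_between hr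
  have hs0 : 0 ≤ s := (abs_nonneg r).trans hrs.le
  have hstep (η : ℝ) (hη : 0 < η) : ∀ᶠ n in atTop, |e n| ≤ s * |e (n / 2)| + (1 - s) * η := by
    have hδ' := hδ.abs
    rw [abs_zero] at hδ'
    filter_upwards [he, hq.abs.eventually_le_const hrs,
      hδ'.eventually_le_const (mul_pos (sub_pos.2 hs1) hη)] with n h₁ h₂ h₃
    rw [h₁]
    refine (abs_add_le _ _).trans (add_le_add ?_ h₃)
    rw [abs_mul]
    gcongr
  obtain ⟨B, hB0, hB⟩ : ∃ B, 0 ≤ B ∧ ∀ n, |e n| ≤ B := by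
    obtain ⟨N, hN⟩ := eventually_atTop.1 (hstep 1 one_pos)
    let C := 1 + ∑ i ∈ range (N + 1), |e i|
    have hC : 1 ≤ C := le_add_of_nonneg_right (sum_nonneg fun _ _ => abs_nonneg _)
    refine ⟨C, by linarith, fun n => ?_⟩
    induction n using Nat.strong_induction_on with
    | _ n ih =>
      by_cases hn : n ≤ N
      · have := single_le_sum (f := fun i => |e i|) (fun _ _ => abs_nonneg _)
          (mem_range.2 (Nat.lt_succ_of_le hn))
        simp only [C]
        linarith
      · have h₁ := hN n (by omega)
        have h₂ := ih (n / 2) (by omega)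
        nlinarith
  have hiter (η : ℝ) (hη : 0 < η) (i : ℕ) : ∀ᶠ n in atTop, |e n| ≤ s ^ i * B + η := by
    induction i with
    | zero => exact Eventually.of_forall fun n => by linarith [hB n]
    | succ i ih =>
      filter_upwards [hstep η hη, (Nat.tendsto_div_const_atTop two_ne_zero).eventually ih]
        with n h₁ h₂
      have := mul_le_mul_of_nonneg_left h₂ hs0
      rw [pow_succ]
      linarith
  rw [Metric.tendsto_nhds]
  intro ε hε
  have hgeo : Tendsto (fun i : ℕ => s ^ i * B) atTop (𝓝 0) := by
    simpa using (tendsto_pow_atTop_nhds_zero_of_lt_one hs0 hs1).mul_const B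
  obtain ⟨i, hi⟩ := (hgeo.eventually_lt_const (half_pos hε)).exists
  filter_upwards [hiter (ε / 2) (half_pos hε) i] with n hn
  rw [Real.dist_eq, sub_zero]
  linarith

theorem sum_Icc_one_eq_sum_range (f : ℕ → ℝ) (n : ℕ) :
    ∑ i ∈ Icc 1 n, f i = ∑ i ∈ range n, f (i + 1) := by
  induction n with
  | zero => simp
  | succ n ih => rw [sum_Icc_succ_top (by omega), ih, sum_range_succ]

theorem tendsto_sum_div_sum_of_tendsto_div {a b : ℕ → ℝ} {c : ℝ} (hb : ∀ i, 1 ≤ i → 0 < b i)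
    (hsum : Tendsto (fun n => ∑ i ∈ Icc 1 n, b i) atTop atTop)
    (hab : Tendsto (fun n => a n / b n) atTop (𝓝 c)) :
    Tendsto (fun n => (∑ i ∈ Icc 1 n, a i) / ∑ i ∈ Icc 1 n, b i) atTop (𝓝 c) := by
  have h₁ : (fun n => a (n + 1) - c * b (n + 1)) =o[atTop] fun n => b (n + 1) := by
    refine (Asymptotics.isLittleO_iff_tendsto fun n hn => absurd hn (hb _ (by omega)).ne').2 ?_
    have := (hab.sub_const c).comp (tendsto_add_atTop_nat 1)
    rw [sub_self] at this
    refine this.congr fun n => ?_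
    have := (hb (n + 1) (by omega)).ne'
    simp only [Function.comp_apply]
    field_simp
  have h₂ := h₁.sum_range (fun n => (hb _ (by omega)).le)
    (by simpa only [sum_Icc_one_eq_sum_range] using hsum)
  have h₃ := h₂.tendsto_div_nhds_zero.add_const c
  rw [zero_add] at h₃
  refine h₃.congr' ?_
  filter_upwards [hsum.eventually_gt_atTop 0] with n hn
  simp only [sum_Icc_one_eq_sum_range] at hn ⊢
  rw [sum_sub_distrib, ← mul_sum]
  field_simp
  ring

theorem tendsto_sum_rpow_div {β : ℝ} (hβ : -1 < β) :
    Tendsto (fun n : ℕ => (∑ i ∈ Icc 1 n, (i : ℝ) ^ β) / (n : ℝ) ^ (β + 1)) atTop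
      (𝓝 (β + 1)⁻¹) := by
  have hβ' : 0 < β + 1 := by linarith
  have htel (n : ℕ) :
      ∑ i ∈ Icc 1 n, ((i : ℝ) ^ (β + 1) - ((i : ℝ) - 1) ^ (β + 1)) = (n : ℝ) ^ (β + 1) := by
    rw [sum_Icc_one_eq_sum_range]
    have := sum_range_sub (fun i : ℕ => (i : ℝ) ^ (β + 1)) n
    simpa [zero_rpow hβ'.ne'] using this
  have hslope : Tendsto
      (fun i : ℕ => ((i : ℝ) ^ (β + 1) - ((i : ℝ) - 1) ^ (β + 1)) / (i : ℝ) ^ β) atTop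
      (𝓝 (β + 1)) := by
    have hd : HasDerivAt (fun t : ℝ => t ^ (β + 1)) (β + 1) 1 := by
      simpa using hasDerivAt_rpow_const (x := 1) (p := β + 1) (Or.inl one_ne_zero)
    have ht : Tendsto (fun i : ℕ => -(i : ℝ)⁻¹) atTop (𝓝[≠] 0) := by
      refine tendsto_nhdsWithin_iff.2
        ⟨by simpa using tendsto_inv_atTop_nhds_zero_nat (𝕜 := ℝ).neg, ?_⟩
      filter_upwards [eventually_ge_atTop 1] with i hi
      have : i ≠ 0 := by omega
      simpa using this
    refine (hd.tendsto_slope_zero.comp ht).congr' ?_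
    filter_upwards [eventually_ge_atTop 1] with i hi
    have hi1 : (1 : ℝ) ≤ i := by exact_mod_cast hi
    have hi0 : (0 : ℝ) < i := by linarith
    have h₁ : 1 + -(i : ℝ)⁻¹ = (i - 1) / i := by field_simp; ring
    simp only [Function.comp_apply, smul_eq_mul]
    rw [h₁, div_rpow (by linarith) hi0.le, one_rpow, rpow_add_one hi0.ne']
    field_simp
    ring
  have h₁ := tendsto_sum_div_sum_of_tendsto_div (a := fun i : ℕ => (i : ℝ) ^ β)
    (b := fun i : ℕ => (i : ℝ) ^ (β + 1) - ((i : ℝ) - 1) ^ (β + 1)) (c := (β + 1)⁻¹) ?_ ?_ ?_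
  · simpa only [htel] using h₁
  · intro i hi
    have hi1 : (1 : ℝ) ≤ i := by exact_mod_cast hi
    exact sub_pos.2 (rpow_lt_rpow (by linarith) (by linarith) hβ')
  · simp only [htel]
    exact (tendsto_rpow_atTop hβ').comp tendsto_natCast_atTop_atTop
  · simpa using hslope.inv₀ hβ'.ne'

namespace IsLocallyUniformlySlowlyVarying

variable {M N : ℕ → ℝ}

theorem tendsto_div (hM : IsLocallyUniformlySlowlyVarying M) {φ : ℕ → ℕ}
    (hle : ∀ n, φ n ≤ n) (hge : ∀ᶠ n in atTop, n ≤ 3 * φ n) :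
    Tendsto (fun n => M (φ n) / M n) atTop (𝓝 1) := by
  rw [Metric.tendsto_nhds]
  intro ε hε
  filter_upwards [hM (ε / 2) (half_pos hε), hge] with n hn hn'
  rw [Real.dist_eq]
  linarith [hn _ (hle n) hn']

theorem tendsto_sub_div (hM : IsLocallyUniformlySlowlyVarying M) (k : ℕ) :
    Tendsto (fun n => M (n - k) / M n) atTop (𝓝 1) := by
  refine hM.tendsto_div (fun n => Nat.sub_le n k) ?_
  filter_upwards [eventually_ge_atTop (2 * k)] with n hn
  omega

theorem tendsto_add_div (hM : IsLocallyUniformlySlowlyVarying M) (k : ℕ) :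
    Tendsto (fun n => M (n + k) / M n) atTop (𝓝 1) := by
  simpa [Function.comp_def] using
    ((hM.tendsto_sub_div k).comp (tendsto_add_atTop_nat k)).inv₀ one_ne_zero

theorem mul (hM : IsLocallyUniformlySlowlyVarying M) (hN : IsLocallyUniformlySlowlyVarying N) :
    IsLocallyUniformlySlowlyVarying fun n => M n * N n := by
  intro ε hε
  have hη : 0 < min (ε / 3) 1 := by positivity
  filter_upwards [hM _ hη, hN _ hη] with n hMn hNn m hmn hnm
  have h₁ := hMn m hmn hnm
  have h₂ := hNn m hmn hnm
  rw [← div_mul_div_comm]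
  generalize M m / M n = a at *
  generalize N m / N n = b at *
  have h₃ : a * b - 1 = (a - 1) * (b - 1) + (a - 1) + (b - 1) := by ring
  have h₄ : |(a - 1) * (b - 1)| ≤ min (ε / 3) 1 * 1 := by
    rw [abs_mul]
    exact mul_le_mul h₁ (h₂.trans (min_le_right _ _)) (abs_nonneg _) hη.le
  rw [h₃]
  linarith [abs_add_three ((a - 1) * (b - 1)) (a - 1) (b - 1), min_le_left (ε / 3) 1]

end IsLocallyUniformlySlowlyVarying

theorem tendsto_natCast_half_div : Tendsto (fun n : ℕ => ((n / 2 : ℕ) : ℝ) / n) atTop (𝓝 2⁻¹) := by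
  refine ((tendsto_nat_floor_mul_div_atTop (a := (2 : ℝ)⁻¹) (by norm_num)).comp
    tendsto_natCast_atTop_atTop).congr fun n => ?_
  have := Nat.floor_div_eq_div (K := ℝ) n 2
  simp only [Function.comp_apply]
  rw [← this, Nat.cast_ofNat, div_eq_inv_mul (n : ℝ) 2]

theorem tendsto_natCast_sub_div (k : ℕ) :
    Tendsto (fun n : ℕ => ((n - k : ℕ) : ℝ) / n) atTop (𝓝 1) := by
  have h₁ : Tendsto (fun n : ℕ => 1 - (k : ℝ) / n) atTop (𝓝 1) := by
    simpa using (tendsto_const_div_atTop_nhds_zero_nat (k : ℝ)).const_sub 1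
  refine h₁.congr' ?_
  filter_upwards [eventually_ge_atTop k, eventually_ge_atTop 1] with n hn hn1
  have : (n : ℝ) ≠ 0 := by exact_mod_cast (by omega : n ≠ 0)
  rw [Nat.cast_sub hn]
  field_simp

theorem sum_Icc_one_add_sum_Ioc (f : ℕ → ℝ) {m n : ℕ} (hmn : m ≤ n) :
    ∑ i ∈ Icc 1 m, f i + ∑ i ∈ Ioc m n, f i = ∑ i ∈ Icc 1 n, f i :=
  sum_Ioc_consecutive f (Nat.zero_le m) hmn

theorem tendsto_sum_Ioc_half_rpow_div {β : ℝ} (hβ : -1 < β) :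
    Tendsto (fun n : ℕ => (∑ i ∈ Ioc (n / 2) n, (i : ℝ) ^ β) / (n : ℝ) ^ (β + 1)) atTop
      (𝓝 ((1 - 2⁻¹ ^ (β + 1)) * (β + 1)⁻¹)) := by
  have hsum := tendsto_sum_rpow_div hβ
  have h₁ := hsum.sub ((hsum.comp (Nat.tendsto_div_const_atTop two_ne_zero)).mul
    (tendsto_natCast_half_div.rpow_const (p := β + 1) (Or.inl (by norm_num))))
  have h₂ : (β + 1)⁻¹ - (β + 1)⁻¹ * 2⁻¹ ^ (β + 1) = (1 - 2⁻¹ ^ (β + 1)) * (β + 1)⁻¹ := by ring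
  rw [h₂] at h₁
  refine h₁.congr' ?_
  filter_upwards [eventually_ge_atTop 2] with n hn
  have hn0 : (0 : ℝ) < (n : ℝ) := by exact_mod_cast (by omega : 0 < n)
  have hh0 : (0 : ℝ) < ((n / 2 : ℕ) : ℝ) := by exact_mod_cast (by omega : 0 < n / 2)
  have h₃ := sum_Icc_one_add_sum_Ioc (fun i : ℕ => (i : ℝ) ^ β) (Nat.div_le_self n 2)
  simp only [Function.comp_apply]
  rw [div_rpow hh0.le hn0.le, div_mul_div_cancel₀ (rpow_pos_of_pos hh0 _).ne', ← sub_div, ← h₃,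
    add_sub_cancel_left]

theorem tendsto_sum_Ioc_half_rpow_mul_div {β : ℝ} (hβ : -1 < β) {M : ℕ → ℝ}
    (hM : IsLocallyUniformlySlowlyVarying M) :
    Tendsto (fun n : ℕ => (∑ i ∈ Ioc (n / 2) n, (i : ℝ) ^ β * M i) / ((n : ℝ) ^ (β + 1) * M n))
      atTop (𝓝 ((1 - 2⁻¹ ^ (β + 1)) * (β + 1)⁻¹)) := by
  refine Asymptotics.IsEquivalent.tendsto_nhds (Asymptotics.IsEquivalent.symm ?_)
    (tendsto_sum_Ioc_half_rpow_div hβ)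
  refine Asymptotics.isLittleO_iff.2 fun ε hε => ?_
  filter_upwards [hM ε hε, eventually_ge_atTop 2] with n hn hn2
  have hterm : ∀ i ∈ Ioc (n / 2) n, |(i : ℝ) ^ β * (M i / M n - 1)| ≤ ε * (i : ℝ) ^ β := by
    intro i hi
    rw [mem_Ioc] at hi
    rw [abs_mul, abs_of_nonneg (by positivity), mul_comm]
    exact mul_le_mul_of_nonneg_right (hn i hi.2 (by omega)) (by positivity)
  have hdiff : (∑ i ∈ Ioc (n / 2) n, (i : ℝ) ^ β * M i) / ((n : ℝ) ^ (β + 1) * M n) -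
      (∑ i ∈ Ioc (n / 2) n, (i : ℝ) ^ β) / (n : ℝ) ^ (β + 1) =
      (∑ i ∈ Ioc (n / 2) n, (i : ℝ) ^ β * (M i / M n - 1)) / (n : ℝ) ^ (β + 1) := by
    rw [mul_comm ((n : ℝ) ^ (β + 1)), ← div_div, ← sub_div, sum_div, ← sum_sub_distrib]
    congr 1
    exact sum_congr rfl fun i _ => by ring
  rw [Pi.sub_apply, hdiff, norm_div, norm_div, ← mul_div_assoc, Real.norm_eq_abs,
    Real.norm_of_nonneg (r := ∑ i ∈ Ioc (n / 2) n, (i : ℝ) ^ β)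
      (sum_nonneg fun i _ => by positivity), mul_sum]
  gcongr
  exact (abs_sum_le_sum_abs _ _).trans (sum_le_sum hterm)

/-- Karamata's theorem for sums of regularly varying sequences. -/
theorem tendsto_sum_rpow_mul_div {β : ℝ} (hβ : -1 < β) {M : ℕ → ℝ}
    (hpos : ∀ n, 0 < M n) (hM : IsLocallyUniformlySlowlyVarying M) :
    Tendsto (fun n : ℕ => (∑ i ∈ Icc 1 n, (i : ℝ) ^ β * M i) / ((n : ℝ) ^ (β + 1) * M n))
      atTop (𝓝 (β + 1)⁻¹) := by
  have hβ' : 0 < β + 1 := by linarith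
  have hr0 : (0 : ℝ) < 2⁻¹ ^ (β + 1) := by positivity
  have hr1 : (2⁻¹ : ℝ) ^ (β + 1) < 1 := rpow_lt_one (by norm_num) (by norm_num) hβ'
  have hq : Tendsto (fun n : ℕ => (((n / 2 : ℕ) : ℝ) / n) ^ (β + 1) * (M (n / 2) / M n)) atTop
      (𝓝 (2⁻¹ ^ (β + 1))) := by
    have h₁ := (tendsto_natCast_half_div.rpow_const (p := β + 1) (Or.inl (by norm_num))).mul
      (hM.tendsto_div (φ := fun n => n / 2) (fun n => Nat.div_le_self n 2) (by
        filter_upwards [eventually_ge_atTop 2] with n hn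
        omega))
    rwa [mul_one] at h₁
  have hblock := tendsto_sum_Ioc_half_rpow_mul_div hβ hM
  have hδ := (hblock.add (hq.mul_const (β + 1)⁻¹)).sub_const (β + 1)⁻¹
  have hzero : (1 - 2⁻¹ ^ (β + 1)) * (β + 1)⁻¹ + 2⁻¹ ^ (β + 1) * (β + 1)⁻¹ - (β + 1)⁻¹ = 0 := by
    ring
  rw [hzero] at hδ
  rw [← tendsto_sub_nhds_zero_iff]
  refine tendsto_zero_of_eq_mul_half_add (by rwa [abs_of_pos hr0]) hq hδ ?_
  filter_upwards [eventually_ge_atTop 2] with n hn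
  have hn0 : (0 : ℝ) < (n : ℝ) := by exact_mod_cast (by omega : 0 < n)
  have hh0 : (0 : ℝ) < ((n / 2 : ℕ) : ℝ) := by exact_mod_cast (by omega : 0 < n / 2)
  have h₁ := (rpow_pos_of_pos hn0 (β + 1)).ne'
  have h₂ := (rpow_pos_of_pos hh0 (β + 1)).ne'
  have h₃ := (hpos n).ne'
  have h₄ := (hpos (n / 2)).ne'
  rw [← sum_Icc_one_add_sum_Ioc (fun i : ℕ => (i : ℝ) ^ β * M i) (Nat.div_le_self n 2),
    div_rpow hh0.le hn0.le]
  field_simp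
  ring

theorem tendsto_rpow_mul_sub_div (γ : ℝ) {M : ℕ → ℝ} (hM : IsLocallyUniformlySlowlyVarying M)
    (k : ℕ) :
    Tendsto (fun n : ℕ => (((n - k : ℕ) : ℝ) ^ γ * M (n - k)) / ((n : ℝ) ^ γ * M n)) atTop
      (𝓝 1) := by
  have h₁ := ((tendsto_natCast_sub_div k).rpow_const (p := γ) (Or.inl one_ne_zero)).mul
    (hM.tendsto_sub_div k)
  rw [one_rpow, mul_one] at h₁
  refine h₁.congr fun n => ?_
  rw [div_rpow (by positivity) (by positivity), div_mul_div_comm]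

theorem tendsto_rpow_mul_add_div (γ : ℝ) {M : ℕ → ℝ} (hM : IsLocallyUniformlySlowlyVarying M)
    (k : ℕ) :
    Tendsto (fun n : ℕ => (((n + k : ℕ) : ℝ) ^ γ * M (n + k)) / ((n : ℝ) ^ γ * M n)) atTop
      (𝓝 1) := by
  simpa [Function.comp_def] using
    ((tendsto_rpow_mul_sub_div γ hM k).comp (tendsto_add_atTop_nat k)).inv₀ one_ne_zero

theorem tendsto_sum_rpow_mul_atTop {β : ℝ} (hβ : -1 < β) {M : ℕ → ℝ}
    (hpos : ∀ n, 0 < M n) (hM : IsLocallyUniformlySlowlyVarying M) :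
    Tendsto (fun n : ℕ => ∑ i ∈ Icc 1 n, (i : ℝ) ^ β * M i) atTop atTop := by
  have hβ' : 0 < β + 1 := by linarith
  have hmono : Monotone fun n : ℕ => ∑ i ∈ Icc 1 n, (i : ℝ) ^ β * M i := fun m n hmn =>
    sum_le_sum_of_subset_of_nonneg (Icc_subset_Icc_right hmn)
      fun i _ _ => mul_nonneg (by positivity) (hpos i).le
  refine (tendsto_atTop_of_monotone hmono).resolve_right ?_
  rintro ⟨s, hs⟩
  have hs0 : 0 < s := lt_of_lt_of_le (by simpa using hpos 1) (hmono.ge_of_tendsto hs 1)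
  have hb : Tendsto (fun n : ℕ => (n : ℝ) ^ (β + 1) * M n) atTop (𝓝 (s / (β + 1)⁻¹)) := by
    refine (hs.div (tendsto_sum_rpow_mul_div hβ hpos hM) (by positivity)).congr' ?_
    filter_upwards [eventually_ge_atTop 1] with n hn
    refine div_div_cancel₀ (sum_pos (fun i hi => ?_) ⟨1, by simpa using hn⟩).ne'
    have : 0 < i := (mem_Icc.1 hi).1
    have := hpos i
    positivity
  have hlim : s / (β + 1)⁻¹ ≠ 0 := by positivity
  have h₁ := (hb.comp (Nat.tendsto_div_const_atTop two_ne_zero)).div hb hlim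
  have h₂ := (tendsto_natCast_half_div.rpow_const (p := β + 1) (Or.inl (by norm_num))).mul
      (hM.tendsto_div (φ := fun n => n / 2) (fun n => Nat.div_le_self n 2) (by
        filter_upwards [eventually_ge_atTop 2] with n hn
        omega))
  have h₃ := tendsto_nhds_unique h₁ (h₂.congr fun n => by
    simp only [Function.comp_apply, Pi.div_apply]
    rw [div_rpow (by positivity) (by positivity), div_mul_div_comm])
  rw [div_self hlim, mul_one] at h₃
  exact (rpow_lt_one (by norm_num) (by norm_num) hβ').ne h₃.symm

section RegularlyVaryingColumns

variable {p : ℕ} {α : Fin p → ℝ} {L : Fin p → ℕ → ℝ} {x : ℕ → Fin p → ℝ}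

theorem sum_mul_eq_sum_rpow_mul
    (hx : ∀ (j : Fin p) (i : ℕ), 1 ≤ i → x i j = (i : ℝ) ^ α j * L j i) (j l : Fin p) (n : ℕ) :
    ∑ i ∈ Icc 1 n, x i j * x i l = ∑ i ∈ Icc 1 n, (i : ℝ) ^ (α j + α l) * (L j i * L l i) := by
  refine sum_congr rfl fun i hi => ?_
  have hi1 := (mem_Icc.1 hi).1
  have hi0 : (0 : ℝ) < i := by exact_mod_cast hi1
  rw [hx j i hi1, hx l i hi1, rpow_add hi0]
  ring

theorem designNorm_eq_sqrt_sum_mul (j : Fin p) (n : ℕ) :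
    designNorm x j n = √(∑ i ∈ Icc 1 n, x i j * x i j) := by
  simp only [designNorm, sq]

theorem monotone_designNorm (j : Fin p) : Monotone (designNorm x j) := fun _ _ hmn =>
  sqrt_le_sqrt (sum_le_sum_of_subset_of_nonneg (Icc_subset_Icc_right hmn) fun _ _ _ => sq_nonneg _)

theorem tendsto_designNorm_atTop (hα : ∀ j, -(1 / 2 : ℝ) < α j) (hLpos : ∀ j n, 0 < L j n)
    (hL : ∀ j, IsLocallyUniformlySlowlyVarying (L j))
    (hx : ∀ (j : Fin p) (i : ℕ), 1 ≤ i → x i j = (i : ℝ) ^ α j * L j i) (j : Fin p) :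
    Tendsto (fun n => designNorm x j n) atTop atTop := by
  simp only [designNorm_eq_sqrt_sum_mul, sum_mul_eq_sum_rpow_mul hx]
  exact tendsto_sqrt_atTop.comp (tendsto_sum_rpow_mul_atTop (by linarith [hα j])
    (fun n => mul_pos (hLpos j n) (hLpos j n)) ((hL j).mul (hL j)))

theorem tendsto_designNorm_div (hα : ∀ j, -(1 / 2 : ℝ) < α j) (hLpos : ∀ j n, 0 < L j n)
    (hL : ∀ j, IsLocallyUniformlySlowlyVarying (L j))
    (hx : ∀ (j : Fin p) (i : ℕ), 1 ≤ i → x i j = (i : ℝ) ^ α j * L j i) (j : Fin p) :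
    Tendsto (fun n : ℕ => designNorm x j n / ((n : ℝ) ^ (α j + 1 / 2) * L j n)) atTop
      (𝓝 (√(2 * α j + 1))⁻¹) := by
  have h₁ := (tendsto_sum_rpow_mul_div (β := α j + α j) (by linarith [hα j])
    (fun n => mul_pos (hLpos j n) (hLpos j n)) ((hL j).mul (hL j))).sqrt
  rw [sqrt_inv, ← two_mul] at h₁
  refine h₁.congr' ?_
  filter_upwards [eventually_ge_atTop 1] with n hn
  have hn0 : (0 : ℝ) < n := by exact_mod_cast hn
  have hLn := hLpos j n
  have h₂ : (n : ℝ) ^ (2 * α j + 1) * (L j n * L j n) = ((n : ℝ) ^ (α j + 1 / 2) * L j n) ^ 2 := by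
    rw [mul_pow, ← rpow_mul_natCast hn0.le, sq (L j n)]
    congr 2
    push_cast
    ring
  rw [designNorm_eq_sqrt_sum_mul, sum_mul_eq_sum_rpow_mul hx, h₂, ← two_mul,
    sqrt_div' _ (sq_nonneg _), sqrt_sq (by positivity)]

theorem tendsto_abs_div_designNorm (hα : ∀ j, -(1 / 2 : ℝ) < α j) (hLpos : ∀ j n, 0 < L j n)
    (hL : ∀ j, IsLocallyUniformlySlowlyVarying (L j))
    (hx : ∀ (j : Fin p) (i : ℕ), 1 ≤ i → x i j = (i : ℝ) ^ α j * L j i) (j : Fin p) :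
    Tendsto (fun n : ℕ => |x n j| / designNorm x j n) atTop (𝓝 0) := by
  have hsqrt : (√(2 * α j + 1))⁻¹ ≠ 0 := (inv_pos.2 (sqrt_pos.2 (by linarith [hα j]))).ne'
  have h₁ := (((tendsto_rpow_neg_atTop (y := 1 / 2) (by norm_num)).comp
    tendsto_natCast_atTop_atTop).mul ((tendsto_designNorm_div hα hLpos hL hx j).inv₀ hsqrt))
  rw [zero_mul] at h₁
  refine h₁.congr' ?_
  filter_upwards [eventually_ge_atTop 1] with n hn
  have hn0 : (0 : ℝ) < n := by exact_mod_cast hn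
  have hLn := hLpos j n
  have h₂ : (n : ℝ) ^ α j = (n : ℝ) ^ (-(1 / 2) : ℝ) * (n : ℝ) ^ (α j + 1 / 2) := by
    rw [← rpow_add hn0]
    congr 1
    ring
  rw [hx j n hn, abs_of_pos (by positivity), h₂, inv_div, Function.comp_apply]
  ring

theorem tendsto_iSup_div_of_tendsto_div {a d : ℕ → ℝ} (ha : ∀ i, 0 ≤ a i) (hd : Monotone d)
    (hd_top : Tendsto d atTop atTop) (had : Tendsto (fun n => a n / d n) atTop (𝓝 0)) :
    Tendsto (fun n => (⨆ i ∈ Icc 1 n, a i) / d n) atTop (𝓝 0) := by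
  rw [Metric.tendsto_nhds]
  intro ε hε
  obtain ⟨N, hN⟩ := eventually_atTop.1
    ((had.eventually_lt_const (half_pos hε)).and (hd_top.eventually_gt_atTop 0))
  have hlarge := hd_top.eventually_ge_atTop ((∑ i ∈ range N, a i) / (ε / 2))
  filter_upwards [hlarge, hd_top.eventually_gt_atTop 0] with n hn hn0
  have hbound (i : ℕ) : ⨆ _ : i ∈ Icc 1 n, a i ≤ ε / 2 * d n := by
    refine Real.iSup_le (fun hi => ?_) (by positivity)
    by_cases hiN : N ≤ i
    · obtain ⟨h₁, h₂⟩ := hN i hiN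
      rw [div_lt_iff₀ h₂] at h₁
      exact h₁.le.trans (mul_le_mul_of_nonneg_left (hd (mem_Icc.1 hi).2) (half_pos hε).le)
    · rw [div_le_iff₀' (half_pos hε)] at hn
      exact (single_le_sum (fun i _ => ha i) (mem_range.2 (not_le.1 hiN))).trans hn
  have h₁ : (⨆ i ∈ Icc 1 n, a i) / d n ≤ ε / 2 := by
    rw [div_le_iff₀ hn0]
    exact Real.iSup_le hbound (by positivity)
  have h₂ : 0 ≤ (⨆ i ∈ Icc 1 n, a i) / d n :=
    div_nonneg (Real.iSup_nonneg fun i => Real.iSup_nonneg fun _ => ha i) hn0.le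
  rw [Real.dist_eq, sub_zero, abs_of_nonneg h₂]
  linarith

theorem tendsto_sum_mul_shift_div (hα : ∀ j, -(1 / 2 : ℝ) < α j) (hLpos : ∀ j n, 0 < L j n)
    (hL : ∀ j, IsLocallyUniformlySlowlyVarying (L j))
    (hx : ∀ (j : Fin p) (i : ℕ), 1 ≤ i → x i j = (i : ℝ) ^ α j * L j i) (j l : Fin p) (k : ℕ) :
    Tendsto (fun n : ℕ => (∑ i ∈ Icc 1 (n - k), x i j * x (i + k) l) /
      ((n : ℝ) ^ (α j + α l + 1) * (L j n * L l n))) atTop (𝓝 (α j + α l + 1)⁻¹) := by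
  have hβ : -1 < α j + α l := by linarith [hα j, hα l]
  have hpos (n : ℕ) : 0 < L j n * L l n := mul_pos (hLpos j n) (hLpos l n)
  have hM := (hL j).mul (hL l)
  have hterm : ∀ i : ℕ, 1 ≤ i → 0 < (i : ℝ) ^ (α j + α l) * (L j i * L l i) := by
    intro i hi
    have hi0 : (0 : ℝ) < i := by exact_mod_cast hi
    exact mul_pos (rpow_pos_of_pos hi0 _) (hpos i)
  have hratio : Tendsto (fun i : ℕ => x i j * x (i + k) l /
      ((i : ℝ) ^ (α j + α l) * (L j i * L l i))) atTop (𝓝 1) := by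
    refine (tendsto_rpow_mul_add_div (α l) (hL l) k).congr' ?_
    filter_upwards [eventually_ge_atTop 1] with i hi
    have hi0 : (0 : ℝ) < i := by exact_mod_cast hi
    have h₁ := (rpow_pos_of_pos hi0 (α j)).ne'
    have h₂ := (hLpos j i).ne'
    rw [hx j i hi, hx l (i + k) (by omega), rpow_add hi0, mul_mul_mul_comm (_ ^ α j) (_ ^ α l),
      mul_div_mul_left _ _ (mul_ne_zero h₁ h₂)]
  have hsum := tendsto_sum_rpow_mul_atTop hβ hpos hM
  have hsub := tendsto_sub_atTop_nat k
  have h₁ := (((tendsto_sum_div_sum_of_tendsto_div hterm hsum hratio).comp hsub).mul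
    ((tendsto_sum_rpow_mul_div hβ hpos hM).comp hsub)).mul
      (tendsto_rpow_mul_sub_div (α j + α l + 1) hM k)
  rw [one_mul, mul_one] at h₁
  refine h₁.congr' ?_
  filter_upwards [hsub.eventually_ge_atTop 1, hsub.eventually (hsum.eventually_gt_atTop 0)]
    with n hn hn'
  have hnk0 : (0 : ℝ) < ((n - k : ℕ) : ℝ) := by exact_mod_cast hn
  have h₂ := mul_pos (rpow_pos_of_pos hnk0 (α j + α l + 1)) (hpos (n - k))
  simp only [Function.comp_apply]
  rw [div_mul_div_cancel₀ hn'.ne', div_mul_div_cancel₀ h₂.ne']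

end RegularlyVaryingColumns

/-- If each design column is regularly varying, `x_{i,j} = i^{α_j} L_j(i)` with
`α_j > −1/2` and `L_j` slowly varying, then the design conditions (C2), (C3), (C4) hold
and `ρ_{j,l}(k) = √(2α_j+1)√(2α_l+1)/(α_j+α_l+1)` for every `k`: the design is regular. -/
theorem regularly_varying_design_is_regular
    (p : ℕ) (hp : 1 ≤ p) (α : Fin p → ℝ) (hα : ∀ j, -(1 / 2 : ℝ) < α j)
    (L : Fin p → ℕ → ℝ) (hLpos : ∀ j n, 0 < L j n) (hLsv : ∀ j, IsSlowlyVaryingSeq (L j))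
    (x : ℕ → Fin p → ℝ) (hx : ∀ (j : Fin p) (i : ℕ), 1 ≤ i → x i j = (i : ℝ) ^ α j * L j i) :
    -- (C2)
    (∀ j, Tendsto (fun n => designNorm x j n) atTop atTop) ∧
    -- (C3)
    (∀ j, Tendsto (fun n => (⨆ i ∈ Icc 1 n, |x i j|) / designNorm x j n) atTop (𝓝 0)) ∧
    -- (C4), with a limit independent of `k`
    (∀ (j l : Fin p) (k : ℕ), Tendsto (fun n =>
        (∑ mm ∈ Icc 1 (n - k), x mm j * x (mm + k) l) /
          (designNorm x j n * designNorm x l n))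
      atTop (𝓝 (Real.sqrt (2 * α j + 1) * Real.sqrt (2 * α l + 1) / (α j + α l + 1)))) := by
  have hL (j : Fin p) := (hLsv j).isLocallyUniformlySlowlyVarying
  have hnorm := tendsto_designNorm_atTop hα hLpos hL hx
  refine ⟨hnorm, fun j => tendsto_iSup_div_of_tendsto_div (fun _ => abs_nonneg _)
    (monotone_designNorm j) (hnorm j) (tendsto_abs_div_designNorm hα hLpos hL hx j),
    fun j l k => ?_⟩
  have hsqrt (j : Fin p) : 0 < √(2 * α j + 1) := sqrt_pos.2 (by linarith [hα j])
  have h₁ := (tendsto_sum_mul_shift_div hα hLpos hL hx j l k).div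
    ((tendsto_designNorm_div hα hLpos hL hx j).mul (tendsto_designNorm_div hα hLpos hL hx l))
    (mul_pos (inv_pos.2 (hsqrt j)) (inv_pos.2 (hsqrt l))).ne'
  have h₂ : (α j + α l + 1)⁻¹ / ((√(2 * α j + 1))⁻¹ * (√(2 * α l + 1))⁻¹) =
      √(2 * α j + 1) * √(2 * α l + 1) / (α j + α l + 1) := by
    rw [← mul_inv, div_inv_eq_mul, inv_mul_eq_div]
  rw [h₂] at h₁
  refine h₁.congr' ?_
  filter_upwards [eventually_ge_atTop 1] with n hn
  have hn0 : (0 : ℝ) < n := by exact_mod_cast hn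
  have h₃ : (n : ℝ) ^ (α j + α l + 1) * (L j n * L l n) =
      (n : ℝ) ^ (α j + 1 / 2) * L j n * ((n : ℝ) ^ (α l + 1 / 2) * L l n) := by
    rw [mul_mul_mul_comm, ← rpow_add hn0]
    congr 2
    ring
  have h₄ : (n : ℝ) ^ (α j + α l + 1) * (L j n * L l n) ≠ 0 :=
    (mul_pos (rpow_pos_of_pos hn0 _) (mul_pos (hLpos j n) (hLpos l n))).ne'
  rw [Pi.div_apply, div_mul_div_comm, ← h₃, div_div_div_cancel_right₀ h₄]

end
end

section
/- Let γ : ℤ → ℝ satisfy γ(−k) = γ(k) and Σ_{k∈ℤ} |γ(k)| < ∞, let K be the kernel with K(x) = 1 for |x| ≤ 1, K(x) = 2 − |x| for 1 ≤ |x| ≤ 2, K(x) = 0 for |x| > 2, and let (c_n) be positive integers with c_n → ∞. Then sup_{λ∈[−π,π]} | (1/(2π)) Σ_{|k|≤n−1} ((n−|k|)/n) K(|k|/c_n) γ(k) e^{ikλ} − (1/(2π)) Σ_{k∈ℤ} γ(k) e^{ikλ} | → 0 as n → ∞. (Equivalently, in the stationary-error setup with γ the autocovariance function, sup_λ |E(f_n(λ))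 − f(λ)| → 0, since E(γ̂_k) = ((n−|k|)/n) γ(k).) -/
open Filter Finset Real Topology

noncomputable section

/-- The trapezoidal kernel: `K(x) = 1` for `|x| ≤ 1`, `K(x) = 2 − |x|` for `1 ≤ |x| ≤ 2`,
`K(x) = 0` for `|x| > 2`. -/
def trapKernel (x : ℝ) : ℝ := if |x| ≤ 1 then 1 else if |x| ≤ 2 then 2 - |x| else 0

theorem trapKernel_nonneg (x : ℝ) : 0 ≤ trapKernel x := by
  unfold trapKernel
  split_ifs <;> linarith

theorem trapKernel_le_one (x : ℝ) : trapKernel x ≤ 1 := by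
  unfold trapKernel
  split_ifs <;> linarith

/-- The taper `((n - |k|) / n) K(|k| / c)` for `|k| ≤ n - 1`, extended by zero. -/
def lagWeight (c n : ℕ) (k : ℤ) : ℝ :=
  if k ∈ Icc (1 - (n : ℤ)) ((n : ℤ) - 1) then
    ((n : ℝ) - |k|) / n * trapKernel ((|k| : ℤ) / (c : ℝ)) else 0

theorem lagWeight_mem_Icc (c n : ℕ) (k : ℤ) : lagWeight c n k ∈ Set.Icc (0 : ℝ) 1 := by
  unfold lagWeight
  split_ifs with h
  · have hk : |k| ≤ (n : ℤ) := abs_le.2 (by rw [Finset.mem_Icc] at h; constructor <;> linarith)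
    have hk' : ((|k| : ℤ) : ℝ) ≤ n := by exact_mod_cast hk
    have hk0 : (0 : ℝ) ≤ ((|k| : ℤ) : ℝ) := by exact_mod_cast abs_nonneg k
    have h0 : 0 ≤ ((n : ℝ) - (|k| : ℤ)) / n := div_nonneg (by linarith) (Nat.cast_nonneg n)
    have h1 : ((n : ℝ) - (|k| : ℤ)) / n ≤ 1 := div_le_one_of_le₀ (by linarith) (Nat.cast_nonneg n)
    exact ⟨mul_nonneg h0 (trapKernel_nonneg _),
      mul_le_one₀ h1 (trapKernel_nonneg _) (trapKernel_le_one _)⟩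
  · simp

theorem tendsto_lagWeight {c : ℕ → ℕ} (hcinf : Tendsto (fun n => (c n : ℝ)) atTop atTop) (k : ℤ) :
    Tendsto (fun n => lagWeight (c n) n k) atTop (𝓝 1) := by
  have hlim : Tendsto (fun n : ℕ => 1 - ((|k| : ℤ) : ℝ) / n) atTop (𝓝 1) := by
    simpa using (tendsto_const_div_atTop_nhds_zero_nat ((|k| : ℤ) : ℝ)).const_sub 1
  refine hlim.congr' ?_
  filter_upwards [hcinf.eventually_ge_atTop ((|k| : ℤ) : ℝ), hcinf.eventually_gt_atTop 0,
    eventually_gt_atTop k.natAbs] with n hkc hc0 hkn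
  have hmem : k ∈ Icc (1 - (n : ℤ)) ((n : ℤ) - 1) := by
    rw [Finset.mem_Icc]; omega
  have hn : (n : ℝ) ≠ 0 := by
    have : n ≠ 0 := by omega
    exact_mod_cast this
  have hk0 : (0 : ℝ) ≤ ((|k| : ℤ) : ℝ) := by exact_mod_cast abs_nonneg k
  have hK : trapKernel ((|k| : ℤ) / (c n : ℝ)) = 1 := by
    unfold trapKernel
    rw [if_pos]
    rw [abs_of_nonneg (by positivity)]
    exact div_le_one_of_le₀ hkc hc0.le
  rw [lagWeight, if_pos hmem, hK, mul_one, sub_div, div_self hn]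

theorem tendsto_tsum_one_sub_lagWeight_mul {γ : ℤ → ℝ} (hsum : Summable fun k : ℤ => |γ k|)
    {c : ℕ → ℕ} (hcinf : Tendsto (fun n => (c n : ℝ)) atTop atTop) :
    Tendsto (fun n => ∑' k : ℤ, (1 - lagWeight (c n) n k) * |γ k|) atTop (𝓝 0) := by
  have key := tendsto_tsum_of_dominated_convergence (𝓕 := atTop)
    (f := fun (n : ℕ) (k : ℤ) => (1 - lagWeight (c n) n k) * |γ k|) (g := fun _ => 0) hsum
    (fun k => by simpa using ((tendsto_lagWeight hcinf k).const_sub 1).mul_const |γ k|)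
    (Eventually.of_forall fun n k => by
      obtain ⟨h0, h1⟩ := lagWeight_mem_Icc (c n) n k
      rw [Real.norm_of_nonneg (mul_nonneg (by linarith) (abs_nonneg _))]
      exact mul_le_of_le_one_left (abs_nonneg _) (by linarith))
  simpa using key

theorem norm_exp_int_mul_ofReal_mul_I (k : ℤ) (x : ℝ) :
    ‖Complex.exp ((k : ℂ) * (x : ℂ) * Complex.I)‖ = 1 := by
  simpa using Complex.norm_exp_ofReal_mul_I ((k : ℝ) * x)

theorem norm_tsum_sub_sum_lagWeight_le {γ : ℤ → ℝ} (hsum : Summable fun k : ℤ => |γ k|)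
    (c n : ℕ) (x : ℝ) :
    ‖(∑' k : ℤ, (γ k : ℂ) * Complex.exp ((k : ℂ) * (x : ℂ) * Complex.I)) -
      ∑ k ∈ Icc (1 - (n : ℤ)) ((n : ℤ) - 1),
        ((((n : ℝ) - |k|) / n : ℝ) : ℂ) * ((trapKernel ((|k| : ℤ) / (c : ℝ)) : ℝ) : ℂ)
          * (γ k : ℂ) * Complex.exp ((k : ℂ) * (x : ℂ) * Complex.I)‖ ≤
      ∑' k : ℤ, (1 - lagWeight c n k) * |γ k| := by
  set e : ℤ → ℂ := fun k => Complex.exp ((k : ℂ) * (x : ℂ) * Complex.I) with he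
  have hfin : ∑ k ∈ Icc (1 - (n : ℤ)) ((n : ℤ) - 1),
        ((((n : ℝ) - |k|) / n : ℝ) : ℂ) * ((trapKernel ((|k| : ℤ) / (c : ℝ)) : ℝ) : ℂ)
          * (γ k : ℂ) * e k = ∑ k ∈ Icc (1 - (n : ℤ)) ((n : ℤ) - 1),
            (lagWeight c n k : ℂ) * (γ k * e k) := by
    refine Finset.sum_congr rfl fun k hk => ?_
    rw [lagWeight, if_pos hk, Complex.ofReal_mul]
    ring
  have hzero : ∀ k ∉ Icc (1 - (n : ℤ)) ((n : ℤ) - 1),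
      (lagWeight c n k : ℂ) * (γ k * e k) = 0 := fun k hk => by
    rw [lagWeight, if_neg hk, Complex.ofReal_zero, zero_mul]
  have hγ : Summable fun k : ℤ => (γ k : ℂ) * e k :=
    Summable.of_norm (by simpa [he, norm_exp_int_mul_ofReal_mul_I] using hsum)
  have hnorm : ∀ k, ‖(γ k : ℂ) * e k - (lagWeight c n k : ℂ) * (γ k * e k)‖ =
      (1 - lagWeight c n k) * |γ k| := fun k => by
    have h1 := (lagWeight_mem_Icc c n k).2
    rw [← one_sub_mul, norm_mul, norm_mul, norm_exp_int_mul_ofReal_mul_I, mul_one,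
      ← Complex.ofReal_one, ← Complex.ofReal_sub, Complex.norm_real, Complex.norm_real,
      Real.norm_of_nonneg (by linarith), Real.norm_eq_abs]
  have hsummable : Summable fun k : ℤ => (1 - lagWeight c n k) * |γ k| :=
    hsum.of_nonneg_of_le
      (fun k => mul_nonneg (by linarith [(lagWeight_mem_Icc c n k).2]) (abs_nonneg _))
      (fun k => mul_le_of_le_one_left (abs_nonneg _) (by linarith [(lagWeight_mem_Icc c n k).1]))
  change ‖(∑' k : ℤ, (γ k : ℂ) * e k) - _‖ ≤ _
  rw [hfin, ← tsum_eq_sum (L := SummationFilter.unconditional ℤ) hzero,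
    ← hγ.tsum_sub (summable_of_ne_finset_zero hzero)]
  simp_rw [← hnorm]
  exact norm_tsum_le_tsum_norm (by simpa only [hnorm] using hsummable)

/-- For a summable symmetric sequence `γ` and `c_n → ∞`,
`sup_{λ∈[−π,π]} |(1/(2π)) Σ_{|k|≤n−1} ((n−|k|)/n) K(|k|/c_n) γ(k) e^{ikλ}
  − (1/(2π)) Σ_{k∈ℤ} γ(k) e^{ikλ}| → 0`. -/
theorem mean_spectral_estimator_tendsto_uniformly
    (γ : ℤ → ℝ) (hsymm : ∀ k : ℤ, γ (-k) = γ k) (hsum : Summable fun k : ℤ => |γ k|)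
    (c : ℕ → ℕ) (hc : ∀ n, 0 < c n) (hcinf : Tendsto (fun n => (c n : ℝ)) atTop atTop) :
    TendstoUniformlyOn
      (fun (n : ℕ) (lam : ℝ) => (1 / (2 * (π : ℂ))) *
        ∑ k ∈ Icc (1 - (n : ℤ)) ((n : ℤ) - 1),
          ((((n : ℝ) - |k|) / n : ℝ) : ℂ) * ((trapKernel ((|k| : ℤ) / (c n : ℝ)) : ℝ) : ℂ)
            * (γ k : ℂ) * Complex.exp ((k : ℂ) * (lam : ℂ) * Complex.I))
      (fun lam : ℝ => (1 / (2 * (π : ℂ))) *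
        ∑' k : ℤ, (γ k : ℂ) * Complex.exp ((k : ℂ) * (lam : ℂ) * Complex.I))
      atTop (Set.Icc (-π) π) := by
  rw [Metric.tendstoUniformlyOn_iff]
  intro ε hε
  filter_upwards [(tendsto_tsum_one_sub_lagWeight_mul hsum hcinf).eventually_lt_const hε]
    with n hn x _
  have hπ : ‖(1 / (2 * (π : ℂ)))‖ ≤ 1 := by
    rw [norm_div, norm_mul, Complex.norm_real, Real.norm_of_nonneg pi_pos.le, norm_one,
      Complex.norm_two]
    exact div_le_one_of_le₀ (by linarith [pi_gt_three]) (by positivity)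
  rw [dist_eq_norm, ← mul_sub, norm_mul]
  exact (mul_le_of_le_one_left (norm_nonneg _) hπ).trans_lt
    ((norm_tsum_sub_sum_lagWeight_le hsum (c n) n x).trans_lt hn)

end
end
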